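/- Let n ≥ 2 and a ≥ 1 be integers and let P_a be the a-handed riffle shuffle transition matrix on S_n. Then the function σ ↦ pk(σ) − (n−2)/3 is a right eigenfunction of P_a with eigenvalue 1/a²: for every σ ∈ S_n, Σ_{τ ∈ S_n} P_a(σ,τ)·(pk(τ) − (n−2)/3) = (1/a²)·(pk(σ) − (n−2)/3). -/

import Mathlib

open Finset

/-- 0-indexed descent set of a deck arrangement: `i ∈ desSet n σ` iff the card at
position `i` is greater than the card at position `i+1` (positions `0, …, n-2`). -/
def desSet (n : ℕ) (σ : Equiv.Perm (Fin n)) : Finset ℕ :=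
  (Finset.range (n - 1)).filter
    (fun i => ∃ h : i + 1 < n, σ ⟨i + 1, h⟩ < σ ⟨i, Nat.lt_of_succ_lt h⟩)

/-- `des σ` is the number of descents of `σ`. -/
def des (n : ℕ) (σ : Equiv.Perm (Fin n)) : ℕ := (desSet n σ).card

/-- 0-indexed peak set: positions `i` with `σ(i) < σ(i+1) > σ(i+2)`. -/
def peakSet (n : ℕ) (σ : Equiv.Perm (Fin n)) : Finset ℕ :=
  (Finset.range (n - 2)).filter
    (fun i => ∃ h : i + 2 < n,
      σ ⟨i, Nat.lt_of_succ_lt (Nat.lt_of_succ_lt h)⟩ < σ ⟨i + 1, Nat.lt_of_succ_lt h⟩ ∧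
      σ ⟨i + 2, h⟩ < σ ⟨i + 1, Nat.lt_of_succ_lt h⟩)

/-- `pk σ` is the number of peaks of `σ`. -/
def pk (n : ℕ) (σ : Equiv.Perm (Fin n)) : ℕ := (peakSet n σ).card

/-- Bayer–Diaconis `a`-handed riffle shuffle transition matrix on `S_n`:
`Pa n a σ τ = C(n + a - 1 - des(τ⁻¹∘σ), n) / a^n`. -/
def Pa (n a : ℕ) : Matrix (Equiv.Perm (Fin n)) (Equiv.Perm (Fin n)) ℚ :=
  fun σ τ => ((n + a - 1 - des n (τ⁻¹ * σ)).choose n : ℚ) / (a : ℚ) ^ n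

/-- Number of non-descents strictly before position `i`. -/
def asc (n : ℕ) (ρ : Equiv.Perm (Fin n)) (i : ℕ) : ℕ :=
  ((Finset.range i).filter (fun k => k ∉ desSet n ρ)).card

lemma asc_succ (n : ℕ) (ρ : Equiv.Perm (Fin n)) (i : ℕ) :
    asc n ρ (i + 1) = asc n ρ i + if i ∈ desSet n ρ then 0 else 1 := by
  unfold asc
  rw [Finset.range_add_one, Finset.filter_insert]
  split_ifs
  · simp_all
  · rw [Finset.card_insert_of_notMem (by simp)]

lemma asc_last (n : ℕ) (ρ : Equiv.Perm (Fin (n + 1))) :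
    asc (n + 1) ρ n + des (n + 1) ρ = n := by
  have h := Finset.card_filter_add_card_filter_not (s := Finset.range n)
    (fun k => k ∈ desSet (n + 1) ρ)
  have h2 : (Finset.range n).filter (fun k => k ∈ desSet (n + 1) ρ) = desSet (n + 1) ρ := by
    ext k
    simp only [Finset.mem_filter, desSet, Nat.add_sub_cancel]
    tauto
  rw [h2, Finset.card_range] at h
  unfold asc des
  omega

lemma mem_desSet_iff (n : ℕ) (ρ : Equiv.Perm (Fin (n + 1))) (i : Fin n) :
    (i : ℕ) ∈ desSet (n + 1) ρ ↔ ρ i.succ < ρ i.castSucc := by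
  unfold desSet
  simp only [Finset.mem_filter, Finset.mem_range, Nat.add_sub_cancel, i.2, true_and]
  constructor
  · rintro ⟨h, h2⟩; exact h2
  · intro h; exact ⟨by have := i.2; omega, h⟩

lemma sort_iff_lex {n a : ℕ} (w : Fin n → Fin a) (ρ : Equiv.Perm (Fin n)) :
    ρ = Tuple.sort w ↔ StrictMono (fun i => toLex (w (ρ i), ρ i)) := by
  rw [Tuple.eq_sort_iff]
  constructor
  · rintro ⟨h1, h2⟩ i j hij
    rw [Prod.Lex.toLex_lt_toLex]
    rcases (h1 hij.le).lt_or_eq with h | h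
    · exact Or.inl h
    · exact Or.inr ⟨h, h2 i j hij h⟩
  · intro h
    refine ⟨fun i j hij => ?_, fun i j hij he => ?_⟩
    · have := h.monotone hij
      rw [Prod.Lex.toLex_le_toLex] at this
      rcases this with h | h
      · exact h.le
      · exact h.1.le
    · have := h hij
      rw [Prod.Lex.toLex_lt_toLex] at this
      rcases this with h | h
      · exact absurd he h.ne
      · exact h.2

lemma sort_iff_step {n a : ℕ} (w : Fin (n + 1) → Fin a) (ρ : Equiv.Perm (Fin (n + 1))) :
    ρ = Tuple.sort w ↔ ∀ i : Fin n,
      (w (ρ i.castSucc) : ℕ) + asc (n + 1) ρ i < (w (ρ i.succ) : ℕ) + asc (n + 1) ρ (i + 1) := by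
  rw [sort_iff_lex, Fin.strictMono_iff_lt_succ]
  refine forall_congr' fun i => ?_
  rw [Prod.Lex.toLex_lt_toLex, asc_succ, Fin.lt_def, Fin.ext_iff]
  have hne : ρ i.castSucc ≠ ρ i.succ := by
    intro h
    have := ρ.injective h
    simp [Fin.ext_iff] at this
  by_cases hd : (i : ℕ) ∈ desSet (n + 1) ρ
  · rw [if_pos hd]
    rw [mem_desSet_iff] at hd
    have := hd.not_gt
    simp only [this, and_false, or_false]
    omega
  · rw [if_neg hd]
    rw [mem_desSet_iff] at hd
    have : ρ i.castSucc < ρ i.succ := lt_of_le_of_ne (not_lt.mp hd) hne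
    simp only [this, and_true]
    omega

lemma asc_mono (n : ℕ) (ρ : Equiv.Perm (Fin n)) : Monotone (asc n ρ) := by
  refine monotone_nat_of_le_succ fun i => ?_
  rw [asc_succ]; omega

lemma strict_sub {n : ℕ} (ρ : Equiv.Perm (Fin (n + 1))) (f : Fin (n + 1) → ℕ)
    (hf : StrictMono f) (i j : Fin (n + 1)) (hij : i ≤ j) :
    f i + asc (n + 1) ρ j ≤ f j + asc (n + 1) ρ i := by
  induction j using Fin.induction with
  | zero => simp at hij; subst hij; exact le_rfl
  | succ j ih =>
    rcases hij.lt_or_eq with h | h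
    · have h1 := ih (Fin.le_castSucc_iff.mpr h)
      have h2 := hf (Fin.castSucc_lt_succ (i := j))
      have h3 := asc_succ (n + 1) ρ j
      simp only [Fin.val_succ, Fin.val_castSucc] at *
      split_ifs at h3 <;> omega
    · subst h; exact le_rfl

lemma asc_le_strict {n : ℕ} (ρ : Equiv.Perm (Fin (n + 1))) (f : Fin (n + 1) → ℕ)
    (hf : StrictMono f) (i : Fin (n + 1)) : asc (n + 1) ρ i ≤ f i := by
  have := strict_sub ρ f hf 0 i (Fin.zero_le _)
  have h0 : asc (n + 1) ρ 0 = 0 := by simp [asc]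
  simp only [Fin.val_zero, h0] at this
  omega

/-- Words sorted by `ρ` correspond to order embeddings. -/
def fiberEquiv {n a : ℕ} (ρ : Equiv.Perm (Fin (n + 1))) :
    {w : Fin (n + 1) → Fin a // ρ = Tuple.sort w} ≃
      (Fin (n + 1) ↪o Fin (a + asc (n + 1) ρ n)) where
  toFun w := OrderEmbedding.ofStrictMono
    (fun i => ⟨(w.1 (ρ i) : ℕ) + asc (n + 1) ρ i, by
      have h1 := (w.1 (ρ i)).2
      have h2 := asc_mono (n + 1) ρ (show (i : ℕ) ≤ n by have := i.2; omega)
      omega⟩)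
    (by
      rw [Fin.strictMono_iff_lt_succ]
      intro i
      exact (sort_iff_step w.1 ρ).1 w.2 i)
  invFun f := ⟨fun p => ⟨(f (ρ⁻¹ p) : ℕ) - asc (n + 1) ρ (ρ⁻¹ p : Fin (n + 1)), by
      have hf : StrictMono (fun i => (f i : ℕ)) := f.strictMono
      have h1 := asc_le_strict ρ _ hf (ρ⁻¹ p)
      have h2 := strict_sub ρ _ hf (ρ⁻¹ p) (Fin.last n) (Fin.le_last _)
      have h3 := (f (Fin.last n)).2
      simp only [Fin.val_last] at *
      omega⟩, by
      have hf : StrictMono (fun i => (f i : ℕ)) := f.strictMono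
      rw [sort_iff_step]
      intro i
      have h1 := asc_le_strict ρ _ hf i.castSucc
      have h2 := asc_le_strict ρ _ hf i.succ
      have h3 := hf (Fin.castSucc_lt_succ (i := i))
      simp only [Equiv.Perm.coe_inv, Equiv.symm_apply_apply, Fin.val_castSucc, Fin.val_succ] at *
      omega⟩
  left_inv w := by
    ext p
    simp
  right_inv f := by
    have hf : StrictMono (fun i => (f i : ℕ)) := f.strictMono
    ext i
    have h1 := asc_le_strict ρ _ hf i
    simp only [OrderEmbedding.coe_ofStrictMono, Equiv.Perm.coe_inv, Equiv.symm_apply_apply]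
    omega

lemma fiber_card {n a : ℕ} (ha : 1 ≤ a) (ρ : Equiv.Perm (Fin (n + 1))) :
    (Finset.univ.filter (fun w : Fin (n + 1) → Fin a => ρ = Tuple.sort w)).card =
      (n + 1 + a - 1 - des (n + 1) ρ).choose (n + 1) := by
  rw [← Fintype.card_subtype, Fintype.card_congr (fiberEquiv ρ),
    ← Nat.card_eq_fintype_card, Nat.card_congr Set.powersetCard.ofFinEmbEquiv,
    Set.powersetCard.card, Nat.card_eq_fintype_card, Fintype.card_fin]
  have := asc_last n ρ
  congr 1
  omega

lemma sum_Pa {n a : ℕ} (ha : 1 ≤ a) (σ : Equiv.Perm (Fin (n + 1)))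
    (F : Equiv.Perm (Fin (n + 1)) → ℚ) :
    ∑ τ, Pa (n + 1) a σ τ * F τ =
      (∑ w : Fin (n + 1) → Fin a, F (σ * (Tuple.sort w)⁻¹)) / (a : ℚ) ^ (n + 1) := by
  have h1 : ∑ w : Fin (n + 1) → Fin a, F (σ * (Tuple.sort w)⁻¹) =
      ∑ ρ : Equiv.Perm (Fin (n + 1)),
        ((n + 1 + a - 1 - des (n + 1) ρ).choose (n + 1) : ℚ) * F (σ * ρ⁻¹) := by
    rw [← Finset.sum_fiberwise Finset.univ (fun w : Fin (n + 1) → Fin a => Tuple.sort w)]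
    refine Finset.sum_congr rfl fun ρ _ => ?_
    rw [← fiber_card ha ρ, ← nsmul_eq_mul, ← Finset.sum_const]
    refine Finset.sum_congr (by ext w; simp [eq_comm]) fun w hw => ?_
    simp only [Finset.mem_filter] at hw
    rw [← hw.2]
  rw [h1, Finset.sum_div]
  refine Fintype.sum_equiv ((Equiv.inv _).trans (Equiv.mulRight σ)) _ _ fun τ => ?_
  simp [Pa]
  ring

/-- Centered peak indicator. -/
def pkf (x y z : ℕ) : ℚ := (if x < y ∧ z < y then 1 else 0) - 1 / 3

/-- Number of letters `< l`, plus the letters equal to `l` before position `i`. -/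
def base {n a : ℕ} (w : Fin n → Fin a) (i : ℕ) (l : Fin a) : ℕ :=
  ∑ q, if w q < l ∨ (w q = l ∧ (q : ℕ) < i) then 1 else 0

lemma sort_inv_eq {n a : ℕ} (w : Fin n → Fin a) (p : Fin n) :
    (((Tuple.sort w)⁻¹ p : Fin n) : ℕ) = base w p (w p) := by
  have hs := (sort_iff_lex w (Tuple.sort w)).1 rfl
  unfold base
  rw [← Equiv.sum_comp (Tuple.sort w)]
  obtain ⟨j, rfl⟩ := (Tuple.sort w).surjective p
  rw [Equiv.Perm.coe_inv, Equiv.symm_apply_apply]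
  have : ∀ q, (w (Tuple.sort w q) < w (Tuple.sort w j) ∨
      (w (Tuple.sort w q) = w (Tuple.sort w j) ∧
        ((Tuple.sort w q : Fin n) : ℕ) < (Tuple.sort w j : Fin n))) ↔ q < j := by
    intro q
    rw [← hs.lt_iff_lt, Prod.Lex.toLex_lt_toLex]
    rfl
  simp only [this]
  rw [← Finset.card_filter]
  have h2 : Finset.univ.filter (fun q => q < j) = Finset.Iio j := by ext; simp
  rw [h2, Fin.card_Iio]

lemma base_succ {n a : ℕ} (w : Fin n → Fin a) (i : Fin n) (l : Fin a) :
    base w (i + 1) l = base w i l + if w i = l then 1 else 0 := by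
  unfold base
  rw [← Fintype.sum_ite_eq i (fun _ => if w i = l then 1 else 0), ← Finset.sum_add_distrib]
  refine Finset.sum_congr rfl fun q _ => ?_
  by_cases hq : i = q
  · subst hq
    by_cases h : w i = l
    · simp [h]
    · simp [h]
  · have : (q : ℕ) < i + 1 ↔ (q : ℕ) < i := by
      have : (i : ℕ) ≠ q := fun h => hq (Fin.ext h)
      omega
    simp [this, hq]

lemma base_comp {n a : ℕ} (w : Fin n → Fin a) (i : ℕ) (l : Fin a) (c : Equiv.Perm (Fin n))
    (hc : ∀ q, (c q : ℕ) < i ↔ (q : ℕ) < i) :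
    base (w ∘ c) i l = base w i l := by
  unfold base
  rw [← Equiv.sum_comp c (fun q => if w q < l ∨ (w q = l ∧ (q : ℕ) < i) then 1 else 0)]
  simp only [hc, Function.comp_apply]

lemma pkf_cancel {a : ℕ} (x y z : Fin a) (S : ℕ → ℕ) (C : Fin a → ℕ)
    (hne : ¬ (x = y ∧ y = z))
    (h1 : S (C x) ≠ S (C y + if x = y then 1 else 0))
    (h2 : S (C x) ≠ S (C z + (if x = z then 1 else 0) + if y = z then 1 else 0))
    (h3 : S (C y + if x = y then 1 else 0) ≠
      S (C z + (if x = z then 1 else 0) + if y = z then 1 else 0)) :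
    pkf (S (C x)) (S (C y + if x = y then 1 else 0))
        (S (C z + (if x = z then 1 else 0) + if y = z then 1 else 0)) +
    pkf (S (C y)) (S (C z + if y = z then 1 else 0))
        (S (C x + (if y = x then 1 else 0) + if z = x then 1 else 0)) +
    pkf (S (C z)) (S (C x + if z = x then 1 else 0))
        (S (C y + (if z = y then 1 else 0) + if x = y then 1 else 0)) = 0 := by
  have key : ∀ u v t : ℕ, u ≠ v → u ≠ t → v ≠ t →
      ((if u < v ∧ t < v then 1 else 0) - 1 / 3 : ℚ) +
      ((if v < t ∧ u < t then 1 else 0) - 1 / 3 : ℚ) +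
      ((if v < u ∧ t < u then 1 else 0) - 1 / 3 : ℚ) = 0 := by
    intro u v t h1 h2 h3
    split_ifs <;> first | omega | norm_num
  unfold pkf
  by_cases hxy : x = y
  · subst hxy
    have hxz : x ≠ z := fun h => hne ⟨rfl, h⟩
    simp only [hxz, hxz.symm, if_true, if_false, add_zero] at h1 h2 h3 ⊢
    have := key _ _ _ h1 h2 h3
    simp only [and_comm] at this ⊢
    linarith
  · by_cases hxz : x = z
    · subst hxz
      simp only [hxy, Ne.symm hxy, if_true, if_false, add_zero] at h1 h2 h3 ⊢
      have := key _ _ _ h1 h2 h3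
      simp only [and_comm] at this ⊢
      linarith
    · by_cases hyz : y = z
      · subst hyz
        simp only [hxy, Ne.symm hxy, if_true, if_false, add_zero] at h1 h2 h3 ⊢
        have := key _ _ _ h1 h2 h3
        simp only [and_comm] at this ⊢
        linarith
      · simp only [hxy, hxz, hyz, Ne.symm hxy, Ne.symm hxz, Ne.symm hyz, if_false, add_zero]
          at h1 h2 h3 ⊢
        have := key _ _ _ h1 h2 h3
        simp only [and_comm] at this ⊢
        linarith

/-- The three positions of the window starting at `i`. -/
def p0 {m : ℕ} (i : Fin m) : Fin (m + 2) := ⟨i, by omega⟩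
/-- Second position of the window. -/
def p1 {m : ℕ} (i : Fin m) : Fin (m + 2) := ⟨i + 1, by omega⟩
/-- Third position of the window. -/
def p2 {m : ℕ} (i : Fin m) : Fin (m + 2) := ⟨i + 2, by omega⟩

/-- Values of `σ` extended to the natural numbers. -/
def extv {n : ℕ} (σ : Equiv.Perm (Fin n)) (k : ℕ) : ℕ := if h : k < n then (σ ⟨k, h⟩ : ℕ) else 0

lemma ext_val {n : ℕ} (σ : Equiv.Perm (Fin n)) (k : Fin n) : extv σ k = σ k := by
  simp [extv]

lemma pk_sub {m : ℕ} (τ : Equiv.Perm (Fin (m + 2))) :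
    (pk (m + 2) τ : ℚ) - (((m + 2 : ℕ) : ℚ) - 2) / 3 =
      ∑ i : Fin m, pkf (τ (p0 i)) (τ (p1 i)) (τ (p2 i)) := by
  unfold pkf
  rw [Finset.sum_sub_distrib]
  congr 1
  · unfold pk peakSet
    rw [Finset.card_filter, Nat.add_sub_cancel, Finset.sum_range]
    push_cast
    refine Finset.sum_congr rfl fun i _ => ?_
    congr 1
    rw [eq_iff_iff]
    constructor
    · rintro ⟨h, h2⟩; exact h2
    · intro h; exact ⟨by omega, h⟩
  · simp
    ring

/-- Contribution of window `i` for the word `w`. -/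
def Hw {m a : ℕ} (σ : Equiv.Perm (Fin (m + 2))) (i : Fin m) (w : Fin (m + 2) → Fin a) : ℚ :=
  pkf ((σ * (Tuple.sort w)⁻¹) (p0 i)) ((σ * (Tuple.sort w)⁻¹) (p1 i))
    ((σ * (Tuple.sort w)⁻¹) (p2 i))

lemma val_base {n a : ℕ} (σ : Equiv.Perm (Fin n)) (w : Fin n → Fin a) (p : Fin n) :
    (((σ * (Tuple.sort w)⁻¹) p : Fin n) : ℕ) = extv σ (base w p (w p)) := by
  rw [← sort_inv_eq, ext_val, Equiv.Perm.mul_apply]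

lemma val0 {m a : ℕ} (σ : Equiv.Perm (Fin (m + 2))) (i : Fin m) (w : Fin (m + 2) → Fin a) :
    (((σ * (Tuple.sort w)⁻¹) (p0 i) : Fin _) : ℕ) = extv σ (base w i (w (p0 i))) :=
  val_base σ w (p0 i)

lemma val1 {m a : ℕ} (σ : Equiv.Perm (Fin (m + 2))) (i : Fin m) (w : Fin (m + 2) → Fin a) :
    (((σ * (Tuple.sort w)⁻¹) (p1 i) : Fin _) : ℕ) =
      extv σ (base w i (w (p1 i)) + if w (p0 i) = w (p1 i) then 1 else 0) := by
  rw [val_base]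
  have := base_succ w (p0 i) (w (p1 i))
  exact congrArg _ this

lemma val2 {m a : ℕ} (σ : Equiv.Perm (Fin (m + 2))) (i : Fin m) (w : Fin (m + 2) → Fin a) :
    (((σ * (Tuple.sort w)⁻¹) (p2 i) : Fin _) : ℕ) =
      extv σ (base w i (w (p2 i)) + (if w (p0 i) = w (p2 i) then 1 else 0) +
        if w (p1 i) = w (p2 i) then 1 else 0) := by
  rw [val_base]
  have h1 := base_succ w (p1 i) (w (p2 i))
  have h0 := base_succ w (p0 i) (w (p2 i))
  rw [← show base w (p0 i + 1) (w (p2 i)) = base w i (w (p2 i)) + _ from h0]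
  exact congrArg _ h1

/-- Cyclic rotation of the window. -/
def cyc {m : ℕ} (i : Fin m) : Equiv.Perm (Fin (m + 2)) :=
  Equiv.swap (p0 i) (p1 i) * Equiv.swap (p1 i) (p2 i)

lemma p01 {m : ℕ} (i : Fin m) : p0 i ≠ p1 i := by simp [p0, p1]
lemma p02 {m : ℕ} (i : Fin m) : p0 i ≠ p2 i := by simp [p0, p2]
lemma p12 {m : ℕ} (i : Fin m) : p1 i ≠ p2 i := by simp [p1, p2]

lemma cyc0 {m : ℕ} (i : Fin m) : cyc i (p0 i) = p1 i := by
  simp [cyc, Equiv.swap_apply_of_ne_of_ne (p01 i) (p02 i)]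
lemma cyc1 {m : ℕ} (i : Fin m) : cyc i (p1 i) = p2 i := by
  simp [cyc, Equiv.swap_apply_of_ne_of_ne (p02 i).symm (p12 i).symm]
lemma cyc2 {m : ℕ} (i : Fin m) : cyc i (p2 i) = p0 i := by
  simp [cyc]

lemma cyc_lt {m : ℕ} (i : Fin m) (q : Fin (m + 2)) :
    (cyc i q : ℕ) < i ↔ (q : ℕ) < i := by
  by_cases h0 : q = p0 i
  · subst h0; rw [cyc0]; simp [p0, p1]
  by_cases h1 : q = p1 i
  · subst h1; rw [cyc1]; simp [p2, p1]
  by_cases h2 : q = p2 i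
  · subst h2; rw [cyc2]; simp [p0, p2]
  rw [cyc, Equiv.Perm.mul_apply, Equiv.swap_apply_of_ne_of_ne h1 h2,
    Equiv.swap_apply_of_ne_of_ne h0 h1]

/-- The word is constant on window `i`. -/
def cst {m a : ℕ} (i : Fin m) (w : Fin (m + 2) → Fin a) : Prop :=
  w (p0 i) = w (p1 i) ∧ w (p1 i) = w (p2 i)

instance {m a : ℕ} (i : Fin m) (w : Fin (m + 2) → Fin a) : Decidable (cst i w) :=
  inferInstanceAs (Decidable (_ ∧ _))

lemma Hw_cancel {m a : ℕ} (σ : Equiv.Perm (Fin (m + 2))) (i : Fin m)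
    (w : Fin (m + 2) → Fin a) (h : ¬ cst i w) :
    Hw σ i w + Hw σ i (w ∘ cyc i) + Hw σ i ((w ∘ cyc i) ∘ cyc i) = 0 := by
  have hinj : ∀ p q : Fin (m + 2), p ≠ q →
      (((σ * (Tuple.sort w)⁻¹) p : Fin _) : ℕ) ≠ ((σ * (Tuple.sort w)⁻¹) q : Fin _) := by
    intro p q hpq he
    exact hpq ((σ * (Tuple.sort w)⁻¹).injective (Fin.ext he))
  have h1 := hinj _ _ (p01 i)
  have h2 := hinj _ _ (p02 i)
  have h3 := hinj _ _ (p12 i)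
  rw [val0, val1] at h1
  rw [val0, val2] at h2
  rw [val1, val2] at h3
  unfold Hw
  simp only [val0, val1, val2, base_comp _ _ _ _ (cyc_lt i), Function.comp_apply, cyc0, cyc1, cyc2]
  exact pkf_cancel _ _ _ (extv σ) (base w i) h h1 h2 h3

lemma cst_cyc {m a : ℕ} (i : Fin m) (w : Fin (m + 2) → Fin a) :
    cst i (w ∘ cyc i) ↔ cst i w := by
  simp only [cst, Function.comp_apply, cyc0, cyc1, cyc2]
  constructor
  · rintro ⟨h1, h2⟩; exact ⟨(h1.trans h2).symm, h1⟩
  · rintro ⟨h1, h2⟩; exact ⟨h2, (h1.trans h2).symm⟩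

lemma sum_comp_cyc {m a : ℕ} (i : Fin m) (F : (Fin (m + 2) → Fin a) → ℚ) :
    ∑ w, F (w ∘ cyc i) = ∑ w, F w :=
  Fintype.sum_equiv (Equiv.arrowCongr (cyc i).symm (Equiv.refl _)) _ _ fun w => by
    congr 1

lemma sum_noncst {m a : ℕ} (σ : Equiv.Perm (Fin (m + 2))) (i : Fin m) :
    ∑ w : Fin (m + 2) → Fin a, (if cst i w then 0 else Hw σ i w) = 0 := by
  have h1 := sum_comp_cyc i (fun w : Fin (m + 2) → Fin a => if cst i w then 0 else Hw σ i w)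
  have h2 := sum_comp_cyc i
    (fun w : Fin (m + 2) → Fin a => if cst i (w ∘ cyc i) then 0 else Hw σ i (w ∘ cyc i))
  have h3 : ∑ w : Fin (m + 2) → Fin a, ((if cst i w then 0 else Hw σ i w) +
      (if cst i (w ∘ cyc i) then 0 else Hw σ i (w ∘ cyc i)) +
      (if cst i ((w ∘ cyc i) ∘ cyc i) then 0 else Hw σ i ((w ∘ cyc i) ∘ cyc i))) = 0 := by
    refine Finset.sum_eq_zero fun w _ => ?_
    simp only [cst_cyc]
    by_cases h : cst i w
    · simp [h]
    · simp only [h, if_false]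
      exact Hw_cancel σ i w h
  rw [Finset.sum_add_distrib, Finset.sum_add_distrib] at h3
  linarith

/-- Contribution of the window starting at `j` in `σ`. -/
def Gf {n : ℕ} (σ : Equiv.Perm (Fin n)) (j : ℕ) : ℚ :=
  pkf (extv σ j) (extv σ (j + 1)) (extv σ (j + 2))

lemma Hw_cst {m a : ℕ} (σ : Equiv.Perm (Fin (m + 2))) (i : Fin m)
    (w : Fin (m + 2) → Fin a) (h : cst i w) :
    Hw σ i w = Gf σ (base w i (w (p0 i))) := by
  unfold Hw Gf
  rw [val0, val1, val2]
  obtain ⟨h1, h2⟩ := h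
  simp [← h2, ← h1]

/-- Collapse the window to a point. -/
def kap {m : ℕ} (i : Fin m) (q : Fin (m + 2)) : Fin m :=
  i.predAbove (i.castSucc.predAbove q)

lemma sum_predAbove {m : ℕ} (i : Fin m) (f : Fin m → ℕ) :
    ∑ q : Fin (m + 1), f (i.predAbove q) = f i + ∑ q, f q := by
  rw [Fin.sum_univ_succAbove _ i.castSucc]
  simp [Fin.predAbove_succAbove]

lemma sum_kap {m : ℕ} (i : Fin m) (f : Fin m → ℕ) :
    ∑ q : Fin (m + 2), f (kap i q) = f i + (f i + ∑ q, f q) := by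
  unfold kap
  rw [sum_predAbove i.castSucc (fun q => f (i.predAbove q)), sum_predAbove]
  simp

lemma predAbove_val {m : ℕ} (i : Fin m) (q : Fin (m + 1)) :
    (i.predAbove q : ℕ) = if (q : ℕ) ≤ i then (q : ℕ) else q - 1 := by
  by_cases h : (q : ℕ) ≤ i
  · rw [if_pos h, Fin.predAbove_of_le_castSucc i q h]
    rfl
  · rw [if_neg h, Fin.predAbove_of_castSucc_lt i q (not_le.mp h)]
    rfl

lemma kap_val {m : ℕ} (i : Fin m) (q : Fin (m + 2)) :
    (kap i q : ℕ) = if (q : ℕ) ≤ i then (q : ℕ) else if (q : ℕ) ≤ i + 2 then (i : ℕ) else q - 2 := by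
  unfold kap
  rw [predAbove_val, predAbove_val, Fin.val_castSucc]
  split_ifs <;> omega

/-- Section of the collapse. -/
def iot {m : ℕ} (i p : Fin m) : Fin (m + 2) :=
  if p ≤ i then ⟨p, by omega⟩ else ⟨p + 2, by omega⟩

lemma kap_iot {m : ℕ} (i p : Fin m) : kap i (iot i p) = p := by
  apply Fin.ext
  rw [kap_val]
  unfold iot
  simp only [Fin.le_def]
  split_ifs <;> simp_all <;> omega

lemma iot_kap {m a : ℕ} (i : Fin m) (w : Fin (m + 2) → Fin a) (h : cst i w) (q : Fin (m + 2)) :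
    w (iot i (kap i q)) = w q := by
  obtain ⟨h1, h2⟩ := h
  have hk := kap_val i q
  by_cases hq1 : q = p1 i
  · have : iot i (kap i q) = p0 i := by
      subst hq1
      apply Fin.ext
      have hk' : (kap i (p1 i) : ℕ) = i := by rw [hk]; simp [p1]
      simp [iot, Fin.le_def, hk', p0]
    rw [this, hq1, h1]
  by_cases hq2 : q = p2 i
  · have : iot i (kap i q) = p0 i := by
      subst hq2
      apply Fin.ext
      have hk' : (kap i (p2 i) : ℕ) = i := by rw [hk]; simp [p2]
      simp [iot, Fin.le_def, hk', p0]
    rw [this, hq2, h1, h2]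
  congr 1
  apply Fin.ext
  have hq1' : (q : ℕ) ≠ i + 1 := fun h => hq1 (Fin.ext h)
  have hq2' : (q : ℕ) ≠ i + 2 := fun h => hq2 (Fin.ext h)
  unfold iot
  simp only [Fin.le_def]
  split_ifs at hk ⊢ <;> simp <;> omega

lemma base_kap {m a : ℕ} (i : Fin m) (v : Fin m → Fin a) :
    base (v ∘ kap i) i (v i) = base v i (v i) := by
  unfold base
  have h := sum_kap i (fun q => if v q < v i ∨ (v q = v i ∧ (q : ℕ) < i) then 1 else 0)
  simp only [lt_irrefl, and_false, or_false, if_false, zero_add] at h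
  rw [← h]
  refine Finset.sum_congr rfl fun q _ => ?_
  have : ((kap i q : Fin m) : ℕ) < i ↔ (q : ℕ) < i := by
    rw [kap_val]
    split_ifs <;> omega
  simp [this]

lemma sum_cst {m a : ℕ} (i : Fin m) (G : ℕ → ℚ) :
    ∑ w : Fin (m + 2) → Fin a, (if cst i w then G (base w i (w (p0 i))) else 0) =
      ∑ v : Fin m → Fin a, G (((Tuple.sort v)⁻¹ i : Fin m) : ℕ) := by
  rw [← Finset.sum_filter]
  symm
  have k0 : kap i (p0 i) = i := by apply Fin.ext; rw [kap_val]; simp [p0]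
  have k1 : kap i (p1 i) = i := by apply Fin.ext; rw [kap_val]; simp [p1]
  have k2 : kap i (p2 i) = i := by apply Fin.ext; rw [kap_val]; simp [p2]
  refine Finset.sum_bij' (fun v _ => v ∘ kap i) (fun w _ => w ∘ iot i) ?_ ?_ ?_ ?_ ?_
  · intro v _
    refine Finset.mem_filter.2 ⟨Finset.mem_univ _, ?_⟩
    simp [cst, k0, k1, k2]
  · simp
  · intro v _
    funext p
    simp [kap_iot]
  · intro w hw
    funext q
    exact iot_kap i w (Finset.mem_filter.1 hw).2 q
  · intro v _
    rw [sort_inv_eq, Function.comp_apply, k0, base_kap]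

lemma sum_Hw {m a : ℕ} (σ : Equiv.Perm (Fin (m + 2))) :
    ∑ w : Fin (m + 2) → Fin a, ∑ i : Fin m, Hw σ i w =
      (a : ℚ) ^ m * ∑ j : Fin m, Gf σ j := by
  rw [Finset.sum_comm]
  have h : ∀ i : Fin m, ∑ w : Fin (m + 2) → Fin a, Hw σ i w =
      ∑ v : Fin m → Fin a, Gf σ (((Tuple.sort v)⁻¹ i : Fin m) : ℕ) := by
    intro i
    have h0 := sum_noncst (a := a) σ i
    rw [← sum_cst i (Gf σ)]
    refine Eq.trans ?_ ((congrArg₂ (· + ·) rfl h0).trans (add_zero _))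
    rw [← Finset.sum_add_distrib]
    refine Finset.sum_congr rfl fun w _ => ?_
    by_cases hc : cst i w
    · simp [hc, Hw_cst σ i w hc]
    · simp [hc]
  rw [Finset.sum_congr rfl fun i _ => h i, Finset.sum_comm]
  have h2 : ∀ v : Fin m → Fin a, ∑ i : Fin m, Gf σ (((Tuple.sort v)⁻¹ i : Fin m) : ℕ) =
      ∑ j : Fin m, Gf σ j := fun v =>
    Equiv.sum_comp (Tuple.sort v)⁻¹ (fun j : Fin m => Gf σ j)
  rw [Finset.sum_congr rfl fun v _ => h2 v]
  simp

/-- `σ ↦ pk(σ) - (n-2)/3` is a right eigenfunction of the `a`-handed riffle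
shuffle transition matrix with eigenvalue `1/a²`. -/
theorem stmt18 (n a : ℕ) (hn : 2 ≤ n) (ha : 1 ≤ a) (σ : Equiv.Perm (Fin n)) :
    ∑ τ : Equiv.Perm (Fin n), Pa n a σ τ * ((pk n τ : ℚ) - ((n : ℚ) - 2) / 3) =
      (1 / (a : ℚ) ^ 2) * ((pk n σ : ℚ) - ((n : ℚ) - 2) / 3) := by
  obtain ⟨m, rfl⟩ : ∃ m, n = m + 2 := ⟨n - 2, by omega⟩
  have hσ : ∑ i : Fin m, pkf (σ (p0 i)) (σ (p1 i)) (σ (p2 i)) = ∑ j : Fin m, Gf σ j := by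
    refine Finset.sum_congr rfl fun i _ => ?_
    rw [← ext_val, ← ext_val, ← ext_val]
    rfl
  have hsum := sum_Hw (a := a) σ
  unfold Hw at hsum
  rw [sum_Pa (n := m + 1) ha σ]
  simp only [pk_sub]
  rw [hσ, hsum]
  have ha0 : (a : ℚ) ≠ 0 := by positivity
  field_simp
  ring
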